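/- Let p be an odd prime and K a finite field extension of ℚ_p. Let Q₀ be an anisotropic quadratic form of degree d over K, and let a ≥ 1 be an integer with a ≡ d (mod 2). Let N be the number of a-tuples in (Kˣ/(Kˣ)²)^a — that is, a-tuples (a₁,…,a_a) of elements of Kˣ counted up to multiplying each entry by a nonzero square — such that the diagonal form ⟨a₁,…,a_a⟩ is Witt equivalent to Q₀. Then, as integers, 8N = 4^a + (2−d)·2^{a+1}. -/

import Mathlib

/-- A quadratic form of degree `m` over `K`: a quadratic form on `Fin m → K`. -/
abbrev QF (K : Type) [Field K] (m : ℕ) : Type := QuadraticForm K (Fin m → K)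

/-- Two quadratic forms are isometric if there is a linear equivalence of the underlying
spaces carrying one to the other. -/
def QIsom {K : Type} [Field K] {M M' : Type} [AddCommGroup M] [Module K M]
    [AddCommGroup M'] [Module K M'] (Q : QuadraticForm K M) (Q' : QuadraticForm K M') : Prop :=
  ∃ φ : M ≃ₗ[K] M', ∀ x, Q' (φ x) = Q x

/-- The hyperbolic plane `(x, y) ↦ x * y` on `K²`. -/
noncomputable def HypForm (K : Type) [Field K] : QuadraticForm K (K × K) :=
  QuadraticMap.linMulLin (LinearMap.fst K K K) (LinearMap.snd K K K)

/-- Orthogonal sum of `m` copies of the hyperbolic plane. -/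
noncomputable def HypSum (K : Type) [Field K] (m : ℕ) : QuadraticForm K (Fin m → K × K) :=
  QuadraticMap.pi (fun _ : Fin m => HypForm K)

/-- Witt equivalence of quadratic forms. -/
def WittEquiv {K : Type} [Field K] {M M' : Type} [AddCommGroup M] [Module K M]
    [AddCommGroup M'] [Module K M'] (Q : QuadraticForm K M) (Q' : QuadraticForm K M') : Prop :=
  ∃ a b : ℕ, QIsom (Q.prod (HypSum K a)) (Q'.prod (HypSum K b))

/-- A quadratic form is nondegenerate if its polar bilinear form is nondegenerate. -/
def QNondeg {K : Type} [Field K] {M : Type} [AddCommGroup M] [Module K M]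
    (Q : QuadraticForm K M) : Prop :=
  ∀ v, (∀ w, QuadraticMap.polar (⇑Q) v w = 0) → v = 0

/-- The diagonal quadratic form `⟨a₁, …, a_m⟩`. -/
noncomputable def diagQF {K : Type} [Field K] {m : ℕ} (r : Fin m → Kˣ) : QF K m :=
  QuadraticMap.weightedSumSquares K (fun i => (r i : K))

/-- The Lie algebra `so(Q)`. -/
def soSet {K : Type} [Field K] {M : Type} [AddCommGroup M] [Module K M]
    (Q : QuadraticForm K M) : Set (Module.End K M) :=
  {X | ∀ v w, QuadraticMap.polar (⇑Q) (X v) w + QuadraticMap.polar (⇑Q) v (X w) = 0}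

/-- Membership in the orthogonal group `O(Q)` (as invertible linear maps preserving `Q`). -/
def InO {K : Type} [Field K] {M : Type} [AddCommGroup M] [Module K M]
    (Q : QuadraticForm K M) (g : M ≃ₗ[K] M) : Prop :=
  ∀ v, Q (g v) = Q v

/-- Membership in the special orthogonal group `SO(Q)`. -/
def InSO {K : Type} [Field K] {M : Type} [AddCommGroup M] [Module K M]
    (Q : QuadraticForm K M) (g : M ≃ₗ[K] M) : Prop :=
  InO Q g ∧ LinearMap.det (g : M →ₗ[K] M) = 1

/-- A nilpotent endomorphism has Jordan type `λ` when `dim ker (X^i) = Σ_j min(i, λ_j)`. -/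
def HasJordanType {K : Type} [Field K] {M : Type} [AddCommGroup M] [Module K M]
    {n : ℕ} (X : Module.End K M) (lam : Nat.Partition n) : Prop :=
  ∀ i : ℕ, Module.finrank K (LinearMap.ker (X ^ i)) = (lam.parts.map (fun part => min i part)).sum

/-- `Λ(n)`: partitions of `n` in which every even part has even multiplicity. -/
def LambdaSet (n : ℕ) : Set (Nat.Partition n) :=
  {lam | ∀ j : ℕ, Even j → Even (lam.parts.count j)}


/-- The properties of the square class map of a nonarchimedean local field
with odd residue characteristic that are used below. -/
structure ClData (K : Type) [Field K] (cl : Kˣ → ZMod 2 × ZMod 2) : Prop where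
  surj : Function.Surjective cl
  mul : ∀ x y, cl (x * y) = cl x + cl y
  sq : ∀ x, cl x = 0 ↔ ∃ s : Kˣ, x = s ^ 2
  neg : (cl (-1)).1 = 0
  b1 : ∀ (c x e : Kˣ) (s t : K), (e : K) = c * s ^ 2 + x * t ^ 2 → (cl c).1 ≠ (cl x).1 →
    cl e = cl c ∨ cl e = cl x
  b2 : ∀ (c x e : Kˣ) (s t : K), (e : K) = c * s ^ 2 + x * t ^ 2 → (cl c).1 = (cl x).1 →
    cl c ≠ cl (-x) → (cl e).1 = (cl c).1
  b3 : ∀ (c x e : Kˣ), (cl c).1 = (cl x).1 → (cl e).1 = (cl c).1 →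
    ∃ s t : K, (e : K) = c * s ^ 2 + x * t ^ 2

section LocalPart
set_option linter.unusedSectionVars false
variable {K : Type} [NontriviallyNormedField K] [IsUltrametricDist K] [ProperSpace K]

lemma lf_norm_eq_of_sub_lt {x y : K} (h : ‖x - y‖ < ‖y‖) : ‖x‖ = ‖y‖ := by
  have := IsUltrametricDist.norm_add_eq_max_of_norm_ne_norm (x := x - y) (y := y) h.ne
  rw [sub_add_cancel, max_eq_right h.le] at this
  exact this

lemma lf_hensel (h2 : ‖(2 : K)‖ = 1) (x : K) (hx : ‖x - 1‖ < 1) : ∃ y : K, y ^ 2 = x := by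
  set r := ‖x - 1‖ with hr
  have hc : IsCompact (Metric.closedBall (1 : K) r) := isCompact_closedBall _ _
  have hne : (Metric.closedBall (1 : K) r).Nonempty := ⟨1, by simp [hr]⟩
  have hcont : ContinuousOn (fun y : K => ‖y ^ 2 - x‖) (Metric.closedBall (1 : K) r) := by
    fun_prop
  obtain ⟨y, hy, hmin⟩ := hc.exists_isMinOn hne hcont
  refine ⟨y, ?_⟩
  by_contra hne
  have hδ : 0 < ‖y ^ 2 - x‖ := norm_pos_iff.mpr (sub_ne_zero.mpr hne)
  rw [mem_closedBall_iff_norm] at hy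
  have hδr : ‖y ^ 2 - x‖ ≤ r := by
    have := hmin (show (1 : K) ∈ Metric.closedBall (1 : K) r by simp [hr])
    simp only [Set.mem_ofPred_eq, one_pow] at this
    rwa [norm_sub_rev 1 x, ← hr] at this
  have hy1 : ‖y‖ = 1 := by
    have : ‖y - 1‖ < ‖(1 : K)‖ := by rw [norm_one]; exact hy.trans_lt hx
    rw [lf_norm_eq_of_sub_lt this, norm_one]
  have hy0 : y ≠ 0 := by intro h; simp [h] at hy1
  have h20 : (2 : K) ≠ 0 := by intro h; simp [h] at h2
  set t := (y ^ 2 - x) / (2 * y) with ht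
  have htn : ‖t‖ = ‖y ^ 2 - x‖ := by simp [ht, h2, hy1]
  have hmem : y - t ∈ Metric.closedBall (1 : K) r := by
    rw [mem_closedBall_iff_norm]
    have := IsUltrametricDist.norm_add_le_max (y - 1) (-t)
    rw [norm_neg] at this
    rw [show y - t - 1 = y - 1 + -t by ring]
    refine this.trans (max_le hy (htn ▸ hδr))
  have h1 := hmin hmem
  simp only [Set.mem_ofPred_eq] at h1
  have h3 : (y - t) ^ 2 - x = t ^ 2 := by
    rw [ht]; field_simp; ring
  rw [h3, norm_pow, htn] at h1
  nlinarith [hδr.trans_lt hx]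

lemma lf_isSquare_of_close (h2 : ‖(2 : K)‖ = 1) {x y : K} (h : ‖x - y‖ < ‖y‖) :
    ∃ s : K, s ≠ 0 ∧ x = y * s ^ 2 := by
  have hy : y ≠ 0 := by rintro rfl; simp at h; exact absurd h (not_lt.mpr (norm_nonneg _))
  have hx : x ≠ 0 := by
    rintro rfl; simp at h
  obtain ⟨s, hs⟩ := lf_hensel h2 (x / y) (by
    rw [show x / y - 1 = (x - y) / y by field_simp, norm_div]
    exact (div_lt_one (norm_pos_iff.mpr hy)).mpr h)
  refine ⟨s, ?_, by rw [hs]; field_simp⟩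
  rintro rfl
  have : x / y ≠ 0 := div_ne_zero hx hy
  simp at hs; tauto

lemma lf_unif : ∃ π : K, π ≠ 0 ∧ ‖π‖ < 1 ∧ ∀ x : K, x ≠ 0 → ∃ n : ℤ, ‖x * π ^ n‖ = 1 := by
  have hc : IsCompact (Metric.ball (0 : K) 1) :=
    Metric.isCompact_of_isClosed_isBounded (IsUltrametricDist.isClosed_ball _ _)
      Metric.isBounded_ball
  obtain ⟨π, hπ, hmax⟩ := hc.exists_isMaxOn ⟨0, by simp⟩ (f := fun x : K => ‖x‖) (by fun_prop)
  obtain ⟨z, hz0, hz1⟩ := NormedField.exists_norm_lt_one K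
  have hmax' : ∀ x : K, ‖x‖ < 1 → ‖x‖ ≤ ‖π‖ := fun x hx => hmax (by simpa using hx)
  have hπ0 : 0 < ‖π‖ := hz0.trans_le (hmax' z hz1)
  have hπ1 : ‖π‖ < 1 := by simpa using hπ
  refine ⟨π, norm_pos_iff.mp hπ0, hπ1, fun x hx => ?_⟩
  obtain ⟨n, h1, h2⟩ := exists_mem_Ico_zpow (norm_pos_iff.mpr hx) (one_lt_inv_iff₀.mpr ⟨hπ0, hπ1⟩)
  refine ⟨n, ?_⟩
  rw [inv_zpow] at h1 h2
  have hpn : 0 < ‖π‖ ^ n := zpow_pos hπ0 _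
  have hpn1 : 0 < ‖π‖ ^ (n+1) := zpow_pos hπ0 _
  have h3 : ‖x * π ^ (n + 1)‖ < 1 := by
    rw [norm_mul, norm_zpow]
    rwa [lt_inv_comm₀ (norm_pos_iff.mpr hx) hpn1, inv_eq_one_div, lt_div_iff₀ (norm_pos_iff.mpr hx), mul_comm] at h2
  have h4 := hmax' _ h3
  rw [norm_mul, norm_zpow, zpow_add_one₀ hπ0.ne', ← mul_assoc] at h4
  rw [norm_mul, norm_zpow]
  apply le_antisymm
  · exact le_of_mul_le_mul_right (by linarith) hπ0
  · rwa [inv_eq_one_div, div_le_iff₀ hpn] at h1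

open Valued NormedField in
lemma lf_residue (h2 : ‖(2 : K)‖ = 1) :
    (∀ z w : K, ‖z‖ = 1 → ‖w‖ = 1 → ¬ IsSquare z → ¬ IsSquare w → IsSquare (z * w)) ∧
    (∃ z : K, ‖z‖ = 1 ∧ ¬ IsSquare z) ∧
    (∀ c x e : K, ‖c‖ = 1 → ‖x‖ = 1 → ‖e‖ = 1 → ∃ s t : K, c * s ^ 2 + x * t ^ 2 = e) := by
  let : Valued K NNReal := NormedField.toValued
  have hcomp : IsCompact (X := K) 𝒪[K] := by
    have : ((𝒪[K] : Subring K) : Set K) = Metric.closedBall 0 1 := by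
      ext x; simp [integer.mem_iff]
    rw [this]; exact isCompact_closedBall _ _
  have : CompactSpace 𝒪[K] := isCompact_iff_compactSpace.mp hcomp
  have hlt : ∀ z : 𝒪[K], IsLocalRing.residue 𝒪[K] z = 0 ↔ ‖(z : K)‖ < 1 := by
    intro z
    rw [IsLocalRing.residue_eq_zero_iff, IsLocalRing.mem_maximalIdeal, mem_nonunits_iff,
      integer.isUnit_iff_norm_eq_one]
    exact ⟨fun h => lt_of_le_of_ne (integer.norm_le_one z) h, fun h => h.ne⟩
  have : Finite 𝓀[K] := by
    have ho : IsOpen ((IsLocalRing.maximalIdeal 𝒪[K] : Ideal 𝒪[K]) : Set 𝒪[K]) := by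
      have : ((IsLocalRing.maximalIdeal 𝒪[K] : Ideal 𝒪[K]) : Set 𝒪[K])
          = (fun z : 𝒪[K] => ‖(z : K)‖) ⁻¹' Set.Iio 1 := by
        ext z
        rw [SetLike.mem_coe, ← IsLocalRing.residue_eq_zero_iff, hlt]
        rfl
      rw [this]
      exact isOpen_Iio.preimage (by fun_prop)
    exact AddSubgroup.quotient_finite_of_isOpen (IsLocalRing.maximalIdeal 𝒪[K]).toAddSubgroup ho
  have hsurj := IsLocalRing.residue_surjective (R := 𝒪[K])
  let φ := IsLocalRing.residue 𝒪[K]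
  have hchar : ringChar 𝓀[K] ≠ 2 := by
    intro h
    have : (2 : 𝓀[K]) = 0 := by
      have := ringChar.Nat.cast_ringChar (R := 𝓀[K]); rw [h] at this; exact_mod_cast this
    have h3 : ‖(2 : K)‖ < 1 := (hlt 2).mp (by rw [map_ofNat]; exact this)
    linarith
  have := Fintype.ofFinite 𝓀[K]
  have hsq : ∀ z : 𝒪[K], ‖(z : K)‖ = 1 → (IsSquare (z : K) ↔ IsSquare (φ z)) := by
    intro z hz
    constructor
    · rintro ⟨s, hs⟩
      have hsn : ‖s‖ ≤ 1 := by
        rw [hs, norm_mul] at hz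
        nlinarith [norm_nonneg s]
      refine ⟨φ ⟨s, integer.mem_iff.mpr hsn⟩, ?_⟩
      rw [← map_mul]; congr 1; ext; exact hs
    · rintro ⟨s, hs⟩
      obtain ⟨s, rfl⟩ := hsurj s
      rw [← sub_eq_zero] at hs
      have : φ (z - s * s) = 0 := by simpa using hs
      rw [hlt] at this
      have h4 : ‖(s * s : K) - z‖ < ‖(z : K)‖ := by rw [norm_sub_rev, hz]; simpa using this
      obtain ⟨t, ht0, ht⟩ := lf_isSquare_of_close h2 h4
      refine ⟨s / t, ?_⟩
      field_simp
      rw [pow_two (s : K), ht]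
  have hmem : ∀ z : K, ‖z‖ = 1 → z ∈ 𝒪[K] := fun z hz => integer.mem_iff.mpr hz.le
  have hne : ∀ z : 𝒪[K], ‖(z : K)‖ = 1 → φ z ≠ 0 := fun z hz h => by
    have := (hlt z).mp h; linarith
  refine ⟨?_, ?_, ?_⟩
  · intro z w hz hw hz' hw'
    lift z to 𝒪[K] using hmem z hz
    lift w to 𝒪[K] using hmem w hw
    rw [hsq _ hz] at hz'
    rw [hsq _ hw] at hw'
    have : ((z : K) * w) = ((z * w : 𝒪[K]) : K) := by simp
    rw [this, hsq _ (by simp [hz, hw]), map_mul]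
    classical
    rw [← quadraticChar_one_iff_isSquare (mul_ne_zero (hne z hz) (hne w hw)), map_mul,
      quadraticChar_neg_one_iff_not_isSquare.mpr hz', quadraticChar_neg_one_iff_not_isSquare.mpr hw']
    norm_num
  · obtain ⟨a, ha⟩ := FiniteField.exists_nonsquare hchar
    obtain ⟨z, rfl⟩ := hsurj a
    have hz : ‖(z : K)‖ = 1 := by
      by_contra h
      have := (hlt z).mpr (lt_of_le_of_ne (integer.norm_le_one z) h)
      rw [this] at ha
      exact ha (IsSquare.zero)
    exact ⟨z, hz, fun h => ha ((hsq z hz).mp h)⟩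
  · intro c x e hc hx he
    lift c to 𝒪[K] using hmem c hc
    lift x to 𝒪[K] using hmem x hx
    lift e to 𝒪[K] using hmem e he
    obtain ⟨a, b, hab⟩ := FiniteField.exists_root_sum_quadratic (R := 𝓀[K])
      (f := Polynomial.C (φ c) * Polynomial.X ^ 2)
      (g := Polynomial.C (φ x) * Polynomial.X ^ 2 + Polynomial.C (- φ e))
      (Polynomial.degree_C_mul_X_pow 2 (hne c hc))
      (by
        rw [Polynomial.degree_add_C (by rw [Polynomial.degree_C_mul_X_pow 2 (hne x hx)]; norm_num)]
        exact Polynomial.degree_C_mul_X_pow 2 (hne x hx))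
      (FiniteField.odd_card_of_char_ne_two hchar)
    obtain ⟨s, rfl⟩ := hsurj a
    obtain ⟨t, rfl⟩ := hsurj b
    have h0 : φ (c * s ^ 2 + x * t ^ 2 - e) = 0 := by
      simp only [Polynomial.eval_add, Polynomial.eval_mul, Polynomial.eval_C, Polynomial.eval_pow,
        Polynomial.eval_X] at hab
      simp only [map_sub, map_add, map_mul, map_pow]
      rw [← hab]; ring
    rw [hlt] at h0
    push_cast at h0
    obtain ⟨r, hr0, hr⟩ := lf_isSquare_of_close h2 (x := (c * s ^ 2 + x * t ^ 2 : K)) (y := e)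
      (by rw [he]; exact h0)
    refine ⟨s / r, t / r, ?_⟩
    field_simp
    rw [hr, mul_comm]

lemma lf_cl (h2 : ‖(2 : K)‖ = 1) : ∃ cl : Kˣ → ZMod 2 × ZMod 2, ClData K cl := by
  classical
  obtain ⟨π, hπ0, hπ1, hπ⟩ := lf_unif (K := K)
  obtain ⟨U1, ⟨z, hz1, hz⟩, U3⟩ := lf_residue h2
  have hπpos : 0 < ‖π‖ := norm_pos_iff.mpr hπ0
  choose n hn using fun x : Kˣ => hπ x x.ne_zero
  have heq : ∀ (y w : Kˣ) (m : ℤ), ‖(y : K)‖ = ‖(w : K) * π ^ m‖ → n w = n y + m := by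
    intro y w m h
    have h1 := hn y
    have h3 := hn w
    rw [norm_mul, h, norm_mul, mul_assoc, ← norm_mul, ← zpow_add₀ hπ0, norm_zpow] at h1
    rw [norm_mul, norm_zpow] at h3
    have hw : ‖(w : K)‖ ≠ 0 := norm_ne_zero_iff.mpr w.ne_zero
    have h4 := mul_left_cancel₀ hw (h1.trans h3.symm)
    have := zpow_right_injective₀ hπpos hπ1.ne h4
    omega
  have huniq : ∀ (x : Kˣ) (m : ℤ), ‖(x : K) * π ^ m‖ = 1 → n x = m := by
    intro x m h
    have h1 : n 1 = 0 := by
      have h1 := hn 1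
      rw [Units.val_one, one_mul, norm_zpow] at h1
      exact zpow_right_injective₀ hπpos hπ1.ne (by simpa using h1)
    have := heq 1 x m (by simp [h])
    omega
  have hnmul : ∀ x y, n (x * y) = n x + n y := by
    intro x y
    apply huniq
    rw [Units.val_mul, zpow_add₀ hπ0, show (x * y : K) * (π ^ n x * π ^ n y) =
      (x * π ^ n x) * (y * π ^ n y) by ring, norm_mul, hn, hn, one_mul]
  let u : Kˣ → K := fun x => x * π ^ n x
  have hu0 : ∀ x, u x ≠ 0 := fun x => mul_ne_zero x.ne_zero (zpow_ne_zero _ hπ0)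
  have humul : ∀ x y, u (x * y) = u x * u y := by
    intro x y
    simp only [u, hnmul, Units.val_mul, zpow_add₀ hπ0]; ring
  have hnsq : ∀ x y : K, x ≠ 0 → IsSquare x → ¬ IsSquare y → ¬ IsSquare (x * y) := by
    rintro x y hx ⟨s, rfl⟩ hy ⟨t, ht⟩
    have hs : s ≠ 0 := by rintro rfl; simp at hx
    refine hy ⟨t / s, ?_⟩
    field_simp
    rw [pow_two, pow_two, ← ht]; ring
  let cl : Kˣ → ZMod 2 × ZMod 2 := fun x => ((n x : ZMod 2), if IsSquare (u x) then 0 else 1)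
  have hmul : ∀ x y, cl (x * y) = cl x + cl y := by
    intro x y
    simp only [cl, hnmul, humul, Prod.mk_add_mk, Prod.mk.injEq]
    refine ⟨by push_cast; rfl, ?_⟩
    by_cases hx : IsSquare (u x) <;> by_cases hy : IsSquare (u y)
    · simp [hx, hy, hx.mul hy]
    · simp [hx, hy, hnsq _ _ (hu0 x) hx hy]
    · simp [hx, hy, mul_comm (u x), hnsq _ _ (hu0 y) hy hx]
    · rw [if_pos (U1 _ _ (hn x) (hn y) hx hy), if_neg hx, if_neg hy]; rfl
  have hsq : ∀ x, cl x = 0 ↔ ∃ s : Kˣ, x = s ^ 2 := by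
    intro x
    constructor
    · intro h
      simp only [cl, Prod.mk_eq_zero] at h
      obtain ⟨h1, h3⟩ := h
      rw [ZMod.intCast_zmod_eq_zero_iff_dvd] at h1
      obtain ⟨k, hk⟩ := h1
      have h4 : IsSquare (u x) := by
        by_contra h; simp [h] at h3
      obtain ⟨s, hs⟩ := h4
      have hs0 : s ≠ 0 := by rintro rfl; exact hu0 x (by simpa using hs)
      refine ⟨Units.mk0 (s * π ^ (-k)) (mul_ne_zero hs0 (zpow_ne_zero _ hπ0)), ?_⟩
      ext
      simp only [Units.val_pow_eq_pow_val, Units.val_mk0]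
      rw [mul_pow, pow_two s, ← hs]
      simp only [u]
      rw [hk, mul_assoc, ← zpow_natCast, ← zpow_mul, ← zpow_add₀ hπ0]
      ring_nf; simp
    · rintro ⟨s, rfl⟩
      rw [pow_two, hmul]
      exact CharTwo.add_self_eq_zero _
  have hcls : ∀ (e y : Kˣ) (s : K), (e : K) = y * s ^ 2 → cl e = cl y := by
    intro e y s h
    have hs : s ≠ 0 := by rintro rfl; simp at h
    have : e = y * (Units.mk0 s hs) ^ 2 := by ext; simp [h]
    rw [this, hmul, (hsq _).mpr ⟨_, rfl⟩, add_zero]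
  have hfst : ∀ (e c : Kˣ) (s : K), ‖(e : K)‖ = ‖(c : K) * s ^ 2‖ → (cl e).1 = (cl c).1 := by
    intro e c s h
    have hs : s ≠ 0 := by rintro rfl; simp at h
    rw [← hcls (c * (Units.mk0 s hs) ^ 2) c s (by simp)]
    have := heq e (c * (Units.mk0 s hs) ^ 2) 0 (by simpa using h)
    simp only [cl]
    rw [this, add_zero]
  have hdom : ∀ (c e : Kˣ) (s w : K), (e : K) = c * s ^ 2 + w → ‖w‖ < ‖(c : K) * s ^ 2‖ →
      cl e = cl c := by
    intro c e s w h hw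
    obtain ⟨r, -, hr⟩ := lf_isSquare_of_close h2 (x := (e : K)) (y := c * s ^ 2) (by
      rw [h, add_sub_cancel_left]; exact hw)
    exact hcls e c (s * r) (by rw [hr]; ring)
  refine ⟨cl, ?_, hmul, hsq, ?_, ?_, ?_, ?_⟩
  · have hz0 : z ≠ 0 := by rintro rfl; simp at hz1
    have c1 : cl (Units.mk0 z hz0) = (0, 1) := by
      have : n (Units.mk0 z hz0) = 0 := huniq _ 0 (by simpa using hz1)
      simp [cl, u, this, hz]
    have c2 : cl (Units.mk0 π hπ0) = (1, 0) := by
      have : n (Units.mk0 π hπ0) = -1 := huniq _ (-1) (by simp [hπ0])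
      simp only [cl, u, this]
      simp [hπ0]
    have c0 : cl 1 = 0 := (hsq 1).mpr ⟨1, by simp⟩
    intro g
    have hg : g = 0 ∨ g = (0, 1) ∨ g = (1, 0) ∨ g = (1, 0) + (0, 1) := by
      revert g; decide
    rcases hg with rfl | rfl | rfl | rfl
    · exact ⟨_, c0⟩
    · exact ⟨_, c1⟩
    · exact ⟨_, c2⟩
    · exact ⟨Units.mk0 π hπ0 * Units.mk0 z hz0, by rw [hmul, c2, c1]⟩
  · have : n (-1) = 0 := huniq _ 0 (by simp)
    simp [cl, this]
  · intro c x e s t h hne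
    rcases lt_trichotomy ‖(c : K) * s ^ 2‖ ‖(x : K) * t ^ 2‖ with h1 | h1 | h1
    · right
      exact hdom x e t _ (by rw [h, add_comm]) h1
    · exfalso
      by_cases hs : s = 0
      · subst hs
        have : (x : K) * t ^ 2 = 0 := by rw [← norm_eq_zero, ← h1]; simp
        exact e.ne_zero (by rw [h, this]; simp)
      · have := hfst (c * (Units.mk0 s hs) ^ 2) x t (by simpa using h1)
        rw [hcls (c * (Units.mk0 s hs) ^ 2) c s (by simp)] at this
        exact hne this
    · left
      exact hdom c e s _ h h1
  · intro c x e s t h hpar hne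
    rcases lt_trichotomy ‖(c : K) * s ^ 2‖ ‖(x : K) * t ^ 2‖ with h1 | h1 | h1
    · rw [hpar, hdom x e t _ (by rw [h, add_comm]) h1]
    · by_cases h3 : ‖(e : K)‖ < ‖(c : K) * s ^ 2‖
      · exfalso
        obtain ⟨r, hr0, hr⟩ := lf_isSquare_of_close h2 (x := -(x * t ^ 2 : K)) (y := c * s ^ 2) (by
          rw [show -(x * t ^ 2 : K) - c * s ^ 2 = -(e : K) by rw [h]; ring, norm_neg]; exact h3)
        have ht : t ≠ 0 := by
          rintro rfl
          rw [h1] at h3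
          simp only [ne_eq, OfNat.ofNat_ne_zero, not_false_eq_true, zero_pow, mul_zero, norm_zero] at h3
          exact absurd h3 (not_lt.mpr (norm_nonneg _))
        apply hne
        symm
        apply hcls _ _ (s * r / t)
        simp only [Units.val_neg]
        field_simp
        linear_combination hr
      · refine hfst e c s (le_antisymm ?_ (not_lt.mp h3))
        rw [h]
        refine (IsUltrametricDist.norm_add_le_max _ _).trans ?_
        rw [← h1, max_self]
    · rw [hdom c e s _ h h1]
  · intro c x e hx he
    obtain ⟨s, t, hst⟩ := U3 (u c) (u x) (u e) (hn c) (hn x) (hn e)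
    simp only [cl] at hx he
    obtain ⟨k, hk⟩ := (ZMod.intCast_eq_intCast_iff_dvd_sub _ _ 2).mp hx
    obtain ⟨l, hl⟩ := (ZMod.intCast_eq_intCast_iff_dvd_sub _ _ 2).mp he
    push_cast at hk hl
    have hk' : n x = n c + 2 * k := by linarith
    have hl' : n e = n c - 2 * l := by linarith
    simp only [u] at hst
    rw [hk', hl', sub_eq_add_neg, zpow_add₀ hπ0, zpow_add₀ hπ0, two_mul, two_mul, neg_add,
      zpow_add₀ hπ0, zpow_add₀ hπ0] at hst
    have hc0 : π ^ n c ≠ 0 := zpow_ne_zero _ hπ0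
    have hl0 : π ^ l ≠ 0 := zpow_ne_zero _ hπ0
    rw [zpow_neg] at hst
    refine ⟨s * π ^ l, t * π ^ k * π ^ l, ?_⟩
    field_simp at hst
    linear_combination (-1 : K) * hst

end LocalPart

section WittPart
variable {K : Type} [Field K]
variable {M₁ M₂ M₃ M₄ : Type} [AddCommGroup M₁] [Module K M₁] [AddCommGroup M₂] [Module K M₂]
  [AddCommGroup M₃] [Module K M₃] [AddCommGroup M₄] [Module K M₄]

/-- The one-dimensional form `c x²`. -/
noncomputable def oneQF (c : Kˣ) : QuadraticForm K K := (c : K) • QuadraticMap.sq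

lemma oneQF_apply (c : Kˣ) (x : K) : oneQF c x = c * x ^ 2 := by
  simp [oneQF, pow_two]

lemma hypSum_apply (m : ℕ) (x : Fin m → K × K) : HypSum K m x = ∑ i, (x i).1 * (x i).2 := by
  simp [HypSum, HypForm]

lemma QIsom.refl (Q : QuadraticForm K M₁) : QIsom Q Q := ⟨LinearEquiv.refl K M₁, fun _ => rfl⟩

lemma QIsom.symm {Q : QuadraticForm K M₁} {Q' : QuadraticForm K M₂} (h : QIsom Q Q') :
    QIsom Q' Q := by
  obtain ⟨φ, hφ⟩ := h
  exact ⟨φ.symm, fun x => by rw [← hφ, LinearEquiv.apply_symm_apply]⟩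

lemma QIsom.trans {Q : QuadraticForm K M₁} {Q' : QuadraticForm K M₂} {Q'' : QuadraticForm K M₃}
    (h : QIsom Q Q') (h' : QIsom Q' Q'') : QIsom Q Q'' := by
  obtain ⟨φ, hφ⟩ := h
  obtain ⟨ψ, hψ⟩ := h'
  exact ⟨φ.trans ψ, fun x => by rw [LinearEquiv.trans_apply, hψ, hφ]⟩

lemma QIsom.prod {Q₁ : QuadraticForm K M₁} {Q₂ : QuadraticForm K M₂} {Q₃ : QuadraticForm K M₃}
    {Q₄ : QuadraticForm K M₄} (h : QIsom Q₁ Q₂) (h' : QIsom Q₃ Q₄) :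
    QIsom (Q₁.prod Q₃) (Q₂.prod Q₄) := by
  obtain ⟨φ, hφ⟩ := h
  obtain ⟨ψ, hψ⟩ := h'
  exact ⟨LinearEquiv.prodCongr φ ψ, fun x => by simp [hφ, hψ]⟩

lemma QIsom.prodComm (Q₁ : QuadraticForm K M₁) (Q₂ : QuadraticForm K M₂) :
    QIsom (Q₁.prod Q₂) (Q₂.prod Q₁) :=
  ⟨LinearEquiv.prodComm K M₁ M₂, fun x => by simp [add_comm]⟩

lemma QIsom.prodAssoc (Q₁ : QuadraticForm K M₁) (Q₂ : QuadraticForm K M₂)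
    (Q₃ : QuadraticForm K M₃) :
    QIsom ((Q₁.prod Q₂).prod Q₃) (Q₁.prod (Q₂.prod Q₃)) :=
  ⟨LinearEquiv.prodAssoc K M₁ M₂ M₃, fun x => by simp [add_assoc]⟩

lemma hypSum_zero (Q : QuadraticForm K M₁) : QIsom (Q.prod (HypSum K 0)) Q :=
  ⟨LinearEquiv.prodUnique, fun x => by simp [hypSum_apply]⟩

lemma hypSum_succ (m : ℕ) : QIsom ((HypForm K).prod (HypSum K m)) (HypSum K (m + 1)) :=
  ⟨Fin.consLinearEquiv K (fun _ : Fin (m + 1) => K × K), fun x => by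
    simp [hypSum_apply, Fin.sum_univ_succ, HypForm]⟩

lemma hypSum_add (a b : ℕ) : QIsom ((HypSum K a).prod (HypSum K b)) (HypSum K (a + b)) := by
  induction a with
  | zero =>
    rw [zero_add]
    exact (QIsom.prodComm _ _).trans (hypSum_zero _)
  | succ n ih =>
    rw [show n + 1 + b = (n + b) + 1 by ring]
    exact ((hypSum_succ n).symm.prod (QIsom.refl _)).trans ((QIsom.prodAssoc _ _ _).trans
      (((QIsom.refl _).prod ih).trans (hypSum_succ _)))

lemma QIsom.witt {Q : QuadraticForm K M₁} {Q' : QuadraticForm K M₂} (h : QIsom Q Q') :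
    WittEquiv Q Q' := ⟨0, 0, h.prod (QIsom.refl _)⟩

lemma WittEquiv.symm' {Q : QuadraticForm K M₁} {Q' : QuadraticForm K M₂} (h : WittEquiv Q Q') :
    WittEquiv Q' Q := by
  obtain ⟨a, b, h⟩ := h
  exact ⟨b, a, h.symm⟩

lemma WittEquiv.trans' {Q : QuadraticForm K M₁} {Q' : QuadraticForm K M₂}
    {Q'' : QuadraticForm K M₃} (h : WittEquiv Q Q') (h' : WittEquiv Q' Q'') :
    WittEquiv Q Q'' := by
  obtain ⟨a, b, h⟩ := h
  obtain ⟨c, d, h'⟩ := h'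
  refine ⟨a + c, d + b, ?_⟩
  refine ((QIsom.refl Q).prod (hypSum_add a c).symm).trans ?_
  refine (QIsom.prodAssoc _ _ _).symm.trans ?_
  refine (h.prod (QIsom.refl _)).trans ?_
  refine (QIsom.prodAssoc _ _ _).trans ?_
  refine ((QIsom.refl Q').prod (QIsom.prodComm _ _)).trans ?_
  refine (QIsom.prodAssoc _ _ _).symm.trans ?_
  refine (h'.prod (QIsom.refl _)).trans ?_
  refine (QIsom.prodAssoc _ _ _).trans ?_
  exact (QIsom.refl Q'').prod (hypSum_add _ _)

lemma WittEquiv.addLeft {Q : QuadraticForm K M₁} {Q' : QuadraticForm K M₂}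
    (P : QuadraticForm K M₃) (h : WittEquiv Q Q') : WittEquiv (P.prod Q) (P.prod Q') := by
  obtain ⟨a, b, h⟩ := h
  exact ⟨a, b, (QIsom.prodAssoc _ _ _).trans
    (((QIsom.refl P).prod h).trans (QIsom.prodAssoc _ _ _).symm)⟩

lemma wittEquiv_hyp (Q : QuadraticForm K M₁) : WittEquiv ((HypForm K).prod Q) Q := by
  refine ⟨0, 1, (hypSum_zero _).trans ((QIsom.prodComm _ _).trans ?_)⟩
  exact (QIsom.refl Q).prod ((hypSum_zero _).symm.trans (hypSum_succ 0))

lemma one_neg_hyp (h2 : (2 : K) ≠ 0) (c : Kˣ) :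
    QIsom ((oneQF (-c)).prod (oneQF c)) (HypForm K) := by
  have hc := c.ne_zero
  refine ⟨LinearEquiv.ofBijective
    ({ toFun := fun x => (c * (x.2 - x.1), x.2 + x.1)
       map_add' := fun x y => by ext <;> simp <;> ring
       map_smul' := fun r x => by ext <;> simp <;> ring } : K × K →ₗ[K] K × K) ⟨?_, ?_⟩, ?_⟩
  · rw [← LinearMap.ker_eq_bot, LinearMap.ker_eq_bot']
    rintro ⟨x, y⟩ h
    simp only [LinearMap.coe_mk, AddHom.coe_mk, Prod.mk_eq_zero, mul_eq_zero, hc, false_or] at h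
    obtain ⟨h1, h3⟩ := h
    have hy : 2 * y = 0 := by linear_combination h1 + h3
    have hx : 2 * x = 0 := by linear_combination h3 - h1
    simp [h2] at hx hy
    simp [hx, hy]
  · rintro ⟨x, y⟩
    refine ⟨((y - x / c) / 2, (y + x / c) / 2), ?_⟩
    simp only [LinearMap.coe_mk, AddHom.coe_mk, Prod.mk.injEq]
    constructor <;> field_simp <;> ring
  · rintro ⟨x, y⟩
    change (c * (y - x)) * (y + x) = _
    simp only [QuadraticMap.prod_apply, oneQF_apply, Units.val_neg]
    ring

lemma witt_cancel (h2 : (2 : K) ≠ 0) (c : Kˣ) (Q : QuadraticForm K M₁) :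
    WittEquiv ((oneQF (-c)).prod ((oneQF c).prod Q)) Q :=
  ((QIsom.prodAssoc _ _ _).symm.trans
    ((one_neg_hyp h2 c).prod (QIsom.refl Q))).witt.trans' (wittEquiv_hyp Q)

lemma witt_move (h2 : (2 : K) ≠ 0) (c : Kˣ) (P : QuadraticForm K M₁) (Q : QuadraticForm K M₂) :
    WittEquiv ((oneQF c).prod P) Q ↔ WittEquiv P ((oneQF (-c)).prod Q) := by
  constructor
  · intro h
    exact (witt_cancel h2 c P).symm'.trans' (h.addLeft _)
  · intro h
    refine (h.addLeft (oneQF c)).trans' ?_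
    have := witt_cancel h2 (-c) Q
    rwa [neg_neg] at this

lemma aniso_witt_zero [FiniteDimensional K M₁] {Q : QuadraticForm K M₁} (hQ : Q.Anisotropic)
    {P : QuadraticForm K M₂} [Subsingleton M₂]
    (h : WittEquiv P Q) : Module.finrank K M₁ = 0 := by
  obtain ⟨a, b, φ, hφ⟩ := h
  have hdim := φ.finrank_eq
  rw [Module.finrank_prod, Module.finrank_prod, Module.finrank_zero_of_subsingleton] at hdim
  simp only [Module.finrank_pi_fintype, Module.finrank_prod, Module.finrank_self,
    Finset.sum_const, Finset.card_univ, Fintype.card_fin, smul_eq_mul] at hdim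
  suffices a ≤ b by omega
  let ι : (Fin a → K) →ₗ[K] M₂ × (Fin a → K × K) :=
    LinearMap.inr K M₂ _ ∘ₗ (LinearMap.inl K K K).compLeft (Fin a)
  let j : (Fin a → K) →ₗ[K] M₁ × (Fin b → K × K) := φ.toLinearMap ∘ₗ ι
  have hj : ∀ x, (Q.prod (HypSum K b)) (j x) = 0 := by
    intro x
    simp only [j, LinearMap.comp_apply, LinearEquiv.coe_coe, hφ]
    simp [ι, hypSum_apply]
  have hjinj : ∀ x, j x = 0 → x = 0 := by
    intro x hx
    simp only [j, LinearMap.comp_apply, LinearEquiv.coe_coe, LinearEquiv.map_eq_zero_iff] at hx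
    ext i
    have := congrFun (congrArg Prod.snd hx) i
    simpa [ι] using this
  let f : (Fin a → K) →ₗ[K] (Fin b → K) :=
    (LinearMap.snd K K K).compLeft (Fin b) ∘ₗ LinearMap.snd K M₁ _ ∘ₗ j
  let g : (Fin a → K) →ₗ[K] (Fin b → K) :=
    (LinearMap.fst K K K).compLeft (Fin b) ∘ₗ LinearMap.snd K M₁ _ ∘ₗ j
  have hf : ∀ x i, f x i = ((j x).2 i).2 := fun x i => rfl
  have hg : ∀ x i, g x i = ((j x).2 i).1 := fun x i => rfl
  have hker : ∀ x, f x = 0 → (j x).1 = 0 := by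
    intro x hx
    have h1 := hj x
    rw [QuadraticMap.prod_apply, hypSum_apply] at h1
    simp only [← hf, hx, Pi.zero_apply, mul_zero, Finset.sum_const_zero, add_zero] at h1
    exact hQ _ h1
  have horth : ∀ x y, f x = 0 → ∑ i, g x i * f y i = 0 := by
    intro x y hx
    have h1 := hj (x + y)
    have h3 := hj y
    rw [QuadraticMap.prod_apply, hypSum_apply] at h1 h3
    simp only [← hf, ← hg] at h1 h3
    simp only [map_add, Prod.fst_add, hker x hx, hx, zero_add, Pi.add_apply, Pi.zero_apply,
      add_mul, Finset.sum_add_distrib] at h1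
    linear_combination h1 - h3
  let e := dotProductEquiv K (Fin b)
  have hle : ((LinearMap.ker f).map g).map e.toLinearMap ≤ (LinearMap.range f).dualAnnihilator := by
    rintro _ ⟨_, ⟨x, hx, rfl⟩, rfl⟩
    rw [Submodule.mem_dualAnnihilator]
    rintro _ ⟨y, rfl⟩
    exact horth x y hx
  have h1 := Submodule.finrank_mono hle
  have h3 := Subspace.finrank_add_finrank_dualAnnihilator_eq (LinearMap.range f)
  have h4 := LinearMap.finrank_range_add_finrank_ker f
  have h5 : Module.finrank K (((LinearMap.ker f).map g).map e.toLinearMap) =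
      Module.finrank K (LinearMap.ker f) := by
    rw [LinearEquiv.finrank_map_eq e]
    rw [← LinearMap.range_domRestrict]
    apply LinearMap.finrank_range_of_inj
    rw [← LinearMap.ker_eq_bot, LinearMap.ker_eq_bot']
    rintro ⟨x, hx⟩ hgx
    ext1
    apply hjinj
    ext1
    · exact hker x hx
    · ext i
      · exact congrFun hgx i
      · exact congrFun hx i
  rw [h5] at h1
  simp only [Module.finrank_fin_fun] at h3 h4
  omega

lemma aniso_split (h2 : (2 : K) ≠ 0) [FiniteDimensional K M₁] {Q : QuadraticForm K M₁}
    (hQ : Q.Anisotropic) (v : M₁) (c : Kˣ) (hv : Q v = c) :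
    ∃ (M' : Type) (_ : AddCommGroup M') (_ : Module K M') (_ : FiniteDimensional K M')
      (Q' : QuadraticForm K M'), Q'.Anisotropic ∧
      Module.finrank K M' + 1 = Module.finrank K M₁ ∧ QIsom Q ((oneQF c).prod Q') := by
  let B : M₁ →ₗ[K] K := Q.polarBilin v
  have hB : ∀ w, B w = QuadraticMap.polar Q v w := fun w => rfl
  have hBv : B v = 2 * c := by
    rw [hB, QuadraticMap.polar_self, hv]; simp
  have hBv0 : B v ≠ 0 := by rw [hBv]; exact mul_ne_zero h2 c.ne_zero
  let N := LinearMap.ker B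
  let Q' : QuadraticForm K N := Q.comp N.subtype
  let ψ : K × N →ₗ[K] M₁ := (LinearMap.toSpanSingleton K M₁ v).coprod N.subtype
  have hψ : ∀ x, ψ x = x.1 • v + x.2 := fun x => rfl
  have hbij : Function.Bijective ψ := by
    constructor
    · rw [← LinearMap.ker_eq_bot, LinearMap.ker_eq_bot']
      rintro ⟨t, w⟩ h
      rw [hψ] at h
      have h1 := congrArg B h
      have hw : B w = 0 := w.2
      simp only [map_add, map_smul, hw, add_zero, map_zero, smul_eq_mul, mul_eq_zero, hBv0,
        or_false] at h1
      subst h1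
      simp at h
      simp [h]
    · intro m
      refine ⟨(B m / B v, ⟨m - (B m / B v) • v, ?_⟩), ?_⟩
      · simp only [N, LinearMap.mem_ker, map_sub, map_smul, smul_eq_mul]
        field_simp; simp
      · rw [hψ]; simp
  let e := LinearEquiv.ofBijective ψ hbij
  refine ⟨N, inferInstance, inferInstance, inferInstance, Q', ?_, ?_, QIsom.symm ⟨e, ?_⟩⟩
  · intro w hw
    ext1
    exact hQ _ hw
  · have := e.finrank_eq
    rw [Module.finrank_prod, Module.finrank_self] at this
    omega
  · rintro ⟨t, w⟩
    change Q (t • v + w) = _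
    have hw : B w = 0 := w.2
    have h3 : QuadraticMap.polar Q (t • v) w = 0 := by
      rw [QuadraticMap.polar_smul_left, ← hB, hw, smul_zero]
    rw [QuadraticMap.polar] at h3
    have h4 : Q (t • v) = c * t ^ 2 := by rw [QuadraticMap.map_smul, hv, smul_eq_mul]; ring
    rw [QuadraticMap.prod_apply, oneQF_apply]
    change _ = _ + Q w
    rw [← h4]
    linear_combination h3

end WittPart

section CountPart

/-- The effect of adding `⟨c⟩` on the set of represented square classes. -/
def stepSet (c : ZMod 2 × ZMod 2) (D : Finset (ZMod 2 × ZMod 2)) : Finset (ZMod 2 × ZMod 2) :=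
  Finset.univ.filter (fun g => g = c ∨ g ∈ D ∨ ∃ x ∈ D, c.1 = x.1 ∧ g.1 = c.1)

set_option maxRecDepth 100000 in
lemma stepSet_card : ∀ s : ZMod 2 × ZMod 2, s.1 = 0 → ∀ (c : ZMod 2 × ZMod 2)
    (D : Finset (ZMod 2 × ZMod 2)), s + c ∉ D → (stepSet c D).card = D.card + 1 := by
  decide

variable {K : Type} [Field K] {cl : Kˣ → ZMod 2 × ZMod 2}
variable {M M' : Type} [AddCommGroup M] [Module K M] [AddCommGroup M'] [Module K M']

lemma ClData.eq_iff (h : ClData K cl) (x y : Kˣ) : cl x = cl y ↔ ∃ u : Kˣ, y = x * u ^ 2 := by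
  constructor
  · intro hxy
    have : cl (x * y) = 0 := by
      rw [h.mul, hxy]
      exact CharTwo.add_self_eq_zero _
    obtain ⟨s, hs⟩ := (h.sq _).mp this
    refine ⟨s * x⁻¹, ?_⟩
    rw [mul_pow, ← hs]
    ext
    push_cast
    field_simp
  · rintro ⟨u, rfl⟩
    rw [h.mul, (h.sq _).mpr ⟨u, rfl⟩, add_zero]

lemma ClData.cl_neg (h : ClData K cl) (x : Kˣ) : cl (-x) = cl (-1) + cl x := by
  rw [← h.mul, neg_one_mul]

open Classical in
/-- The set of square classes represented by `Q`. -/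
noncomputable def repSet (cl : Kˣ → ZMod 2 × ZMod 2) (Q : QuadraticForm K M) :
    Finset (ZMod 2 × ZMod 2) :=
  Finset.univ.filter (fun g => ∃ (v : M) (e : Kˣ), Q v = e ∧ cl e = g)

lemma mem_repSet {Q : QuadraticForm K M} {g : ZMod 2 × ZMod 2} :
    g ∈ repSet cl Q ↔ ∃ (v : M) (e : Kˣ), Q v = e ∧ cl e = g := by
  simp [repSet]

lemma ClData.mem_rep (h : ClData K cl) {Q : QuadraticForm K M} {e : Kˣ} :
    cl e ∈ repSet cl Q ↔ ∃ v : M, Q v = e := by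
  rw [mem_repSet]
  constructor
  · rintro ⟨v, e', hv, he⟩
    obtain ⟨u, rfl⟩ := (h.eq_iff _ _).mp he
    refine ⟨(u : K) • v, ?_⟩
    rw [QuadraticMap.map_smul, hv]
    simp; ring
  · rintro ⟨v, hv⟩
    exact ⟨v, e, hv, rfl⟩

lemma repSet_congr {Q : QuadraticForm K M} {Q' : QuadraticForm K M'} (h : QIsom Q Q') :
    repSet cl Q = repSet cl Q' := by
  obtain ⟨φ, hφ⟩ := h
  ext g
  rw [mem_repSet, mem_repSet]
  constructor
  · rintro ⟨v, e, hv, he⟩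
    exact ⟨φ v, e, by rw [hφ, hv], he⟩
  · rintro ⟨v, e, hv, he⟩
    exact ⟨φ.symm v, e, by rw [← hφ, LinearEquiv.apply_symm_apply, hv], he⟩

lemma aniso_congr {Q : QuadraticForm K M} {Q' : QuadraticForm K M'} (h : QIsom Q Q')
    (hQ : Q.Anisotropic) : Q'.Anisotropic := by
  obtain ⟨φ, hφ⟩ := h.symm
  intro x hx
  exact φ.map_eq_zero_iff.mp (hQ _ (by rw [hφ, hx]))

lemma ClData.not_mem_of_aniso (h : ClData K cl) {c : Kˣ} {Q : QuadraticForm K M}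
    (hQ : ((oneQF c).prod Q).Anisotropic) : cl (-c) ∉ repSet cl Q := by
  rw [h.mem_rep]
  rintro ⟨w, hw⟩
  have := hQ (1, w) (by simp [oneQF_apply, hw])
  simp at this

lemma ClData.aniso_of_not_mem (h : ClData K cl) {c : Kˣ} {Q : QuadraticForm K M}
    (hQ : Q.Anisotropic) (hc : cl (-c) ∉ repSet cl Q) : ((oneQF c).prod Q).Anisotropic := by
  rintro ⟨s, w⟩ hs
  simp only [QuadraticMap.prod_apply, oneQF_apply] at hs
  by_cases h0 : s = 0
  · subst h0
    simp only [ne_eq, OfNat.ofNat_ne_zero, not_false_eq_true, zero_pow, mul_zero, zero_add] at hs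
    simp [hQ w hs]
  · exfalso
    apply hc
    rw [h.mem_rep]
    refine ⟨s⁻¹ • w, ?_⟩
    rw [QuadraticMap.map_smul, smul_eq_mul, Units.val_neg]
    field_simp
    linear_combination hs

lemma ClData.rep_step (h : ClData K cl) {c : Kˣ} {Q : QuadraticForm K M}
    (hQ : ((oneQF c).prod Q).Anisotropic) :
    repSet cl ((oneQF c).prod Q) = stepSet (cl c) (repSet cl Q) := by
  have hn := h.not_mem_of_aniso hQ
  ext g
  obtain ⟨e, rfl⟩ := h.surj g
  rw [h.mem_rep]
  simp only [stepSet, Finset.mem_filter, Finset.mem_univ, true_and]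
  constructor
  · rintro ⟨⟨s, w⟩, hs⟩
    simp only [QuadraticMap.prod_apply, oneQF_apply] at hs
    by_cases hw : Q w = 0
    · left
      rw [hw, add_zero] at hs
      have hs0 : s ≠ 0 := by
        rintro rfl
        exact e.ne_zero (by rw [← hs]; simp)
      symm
      rw [h.eq_iff]
      exact ⟨Units.mk0 s hs0, by ext; simp [hs]⟩
    · obtain ⟨x, hx⟩ : ∃ x : Kˣ, Q w = x := ⟨Units.mk0 _ hw, rfl⟩
      have hxm : cl x ∈ repSet cl Q := h.mem_rep.mpr ⟨w, hx⟩
      have hcx : cl c ≠ cl (-x) := by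
        intro hh
        apply hn
        rw [h.cl_neg, hh, ← h.cl_neg, neg_neg]
        exact hxm
      have he : (e : K) = c * s ^ 2 + x * 1 ^ 2 := by rw [← hs, hx]; ring
      by_cases hp : (cl c).1 = (cl x).1
      · exact Or.inr (Or.inr ⟨_, hxm, hp, h.b2 c x e s 1 he hp hcx⟩)
      · rcases h.b1 c x e s 1 he hp with h1 | h1
        · exact Or.inl h1
        · exact Or.inr (Or.inl (h1 ▸ hxm))
  · rintro (h1 | h1 | ⟨x, hx, hp, hg⟩)
    · obtain ⟨u, rfl⟩ := (h.eq_iff _ _).mp h1.symm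
      exact ⟨((u : K), 0), by simp [oneQF_apply]⟩
    · obtain ⟨w, hw⟩ := h.mem_rep.mp h1
      exact ⟨(0, w), by simp [oneQF_apply, hw]⟩
    · obtain ⟨x, rfl⟩ := h.surj x
      obtain ⟨w, hw⟩ := h.mem_rep.mp hx
      obtain ⟨s, t, hst⟩ := h.b3 c x e hp hg
      refine ⟨(s, t • w), ?_⟩
      simp only [QuadraticMap.prod_apply, oneQF_apply, QuadraticMap.map_smul, hw, hst, smul_eq_mul]
      ring

lemma ClData.rep_card (h : ClData K cl) (h2 : (2 : K) ≠ 0) (n : ℕ) :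
    ∀ (M : Type) [AddCommGroup M] [Module K M] [FiniteDimensional K M] (Q : QuadraticForm K M),
      Q.Anisotropic → Module.finrank K M = n → (repSet cl Q).card = n := by
  induction n with
  | zero =>
    intro M _ _ _ Q hQ hn
    have := Module.finrank_zero_iff.mp hn
    rw [Finset.card_eq_zero, Finset.eq_empty_iff_forall_notMem]
    intro g hg
    obtain ⟨v, e, hv, -⟩ := mem_repSet.mp hg
    rw [Subsingleton.elim v 0, QuadraticMap.map_zero] at hv
    exact e.ne_zero hv.symm
  | succ n ih =>
    intro M _ _ _ Q hQ hn
    have : Nontrivial M := Module.nontrivial_of_finrank_pos (R := K) (by omega)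
    obtain ⟨v, hv⟩ := exists_ne (0 : M)
    have hv' : Q v ≠ 0 := fun h0 => hv (hQ v h0)
    obtain ⟨M', _, _, _, Q', hQ', hd, hi⟩ := aniso_split h2 hQ v (Units.mk0 _ hv') rfl
    have ha := aniso_congr hi hQ
    rw [repSet_congr hi, h.rep_step ha, stepSet_card (cl (-1)) h.neg, ih M' Q' hQ' (by omega)]
    rw [← h.cl_neg]
    exact h.not_mem_of_aniso ha

lemma diag_cons (a : ℕ) (c : Kˣ) (r : Fin a → Kˣ) :
    QIsom ((oneQF c).prod (diagQF r)) (diagQF (Fin.cons c r : Fin (a + 1) → Kˣ)) :=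
  ⟨Fin.consLinearEquiv K (fun _ : Fin (a + 1) => K), fun x => by
    simp [diagQF, QuadraticMap.weightedSumSquares_apply, Fin.sum_univ_succ, oneQF_apply, pow_two]⟩

lemma diag_isom {a : ℕ} {r r' : Fin a → Kˣ} (h : ∀ i, ∃ u : Kˣ, r' i = r i * u ^ 2) :
    QIsom (diagQF r') (diagQF r) := by
  choose u hu using h
  refine ⟨LinearEquiv.piCongrRight (fun i => LinearEquiv.smulOfNeZero K K (u i : K) (u i).ne_zero),
    fun x => ?_⟩
  simp only [diagQF, QuadraticMap.weightedSumSquares_apply]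
  refine Finset.sum_congr rfl fun i _ => ?_
  rw [hu i]
  simp
  ring

open Classical in
/-- The number of `a`-tuples of square classes Witt equivalent to `Q`. -/
noncomputable def cnt (lift : ZMod 2 × ZMod 2 → Kˣ) (a : ℕ) (Q : QuadraticForm K M) : ℤ :=
  ∑ t : Fin a → ZMod 2 × ZMod 2, if WittEquiv (diagQF (fun i => lift (t i))) Q then 1 else 0

variable {lift : ZMod 2 × ZMod 2 → Kˣ}

lemma cnt_congr {a : ℕ} {Q : QuadraticForm K M} {Q' : QuadraticForm K M'} (h : WittEquiv Q Q') :
    cnt lift a Q = cnt lift a Q' := by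
  unfold cnt
  refine Finset.sum_congr rfl fun t _ => ?_
  have : WittEquiv (diagQF (fun i => lift (t i))) Q ↔ WittEquiv (diagQF (fun i => lift (t i))) Q' :=
    ⟨fun h' => h'.trans' h, fun h' => h'.trans' h.symm'⟩
  split_ifs <;> first | rfl | tauto

lemma cnt_succ (h2 : (2 : K) ≠ 0) (a : ℕ) (Q : QuadraticForm K M) :
    cnt lift (a + 1) Q = ∑ g, cnt lift a ((oneQF (-(lift g))).prod Q) := by
  unfold cnt
  rw [← (Fin.consEquiv (fun _ : Fin (a + 1) => ZMod 2 × ZMod 2)).sum_comp, Fintype.sum_prod_type]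
  refine Finset.sum_congr rfl fun g _ => Finset.sum_congr rfl fun t _ => ?_
  have h1 : (fun i => lift (Fin.consEquiv (fun _ : Fin (a + 1) => ZMod 2 × ZMod 2) (g, t) i)) =
      (Fin.cons (lift g) (fun i => lift (t i)) : Fin (a + 1) → Kˣ) := by
    funext i
    refine Fin.cases ?_ (fun i => ?_) i <;> simp [Fin.consEquiv]
  rw [h1]
  have : WittEquiv (diagQF (Fin.cons (lift g) (fun i => lift (t i)) : Fin (a + 1) → Kˣ)) Q ↔
      WittEquiv (diagQF (fun i => lift (t i))) ((oneQF (-(lift g))).prod Q) := by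
    rw [← witt_move h2]
    exact ⟨fun h => (diag_cons _ _ _).witt.trans' h, fun h => (diag_cons _ _ _).symm.witt.trans' h⟩
  split_ifs <;> first | rfl | tauto

lemma cnt_zero [FiniteDimensional K M] {Q : QuadraticForm K M} (hQ : Q.Anisotropic) :
    cnt lift 0 Q = if Module.finrank K M = 0 then 1 else 0 := by
  unfold cnt
  rw [Fintype.sum_unique]
  have : WittEquiv (diagQF (fun i => lift ((default : Fin 0 → ZMod 2 × ZMod 2) i))) Q ↔
      Module.finrank K M = 0 := by
    constructor
    · exact fun h => aniso_witt_zero hQ h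
    · intro h
      have := Module.finrank_zero_iff.mp h
      refine QIsom.witt ⟨LinearEquiv.ofSubsingleton (Fin 0 → K) M, fun x => ?_⟩
      rw [Subsingleton.elim x 0, map_zero, QuadraticMap.map_zero, QuadraticMap.map_zero]
  split_ifs <;> first | rfl | tauto

lemma ClData.child (h : ClData K cl) (h2 : (2 : K) ≠ 0) [FiniteDimensional K M]
    {Q : QuadraticForm K M} (hQ : Q.Anisotropic) (c : Kˣ) :
    ∃ (M' : Type) (_ : AddCommGroup M') (_ : Module K M') (_ : FiniteDimensional K M')
      (Q' : QuadraticForm K M'), Q'.Anisotropic ∧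
      (Module.finrank K M' : ℤ) = Module.finrank K M + 1 - (if cl c ∈ repSet cl Q then 2 else 0) ∧
      WittEquiv ((oneQF (-c)).prod Q) Q' := by
  by_cases hc : cl c ∈ repSet cl Q
  · obtain ⟨v, hv⟩ := h.mem_rep.mp hc
    obtain ⟨M', i1, i2, i3, Q', hQ', hd, hi⟩ := aniso_split h2 hQ v c hv
    refine ⟨M', i1, i2, i3, Q', hQ', ?_, ?_⟩
    · rw [if_pos hc]; omega
    · exact (hi.witt.addLeft _).trans' (witt_cancel h2 c Q')
  · refine ⟨K × M, inferInstance, inferInstance, inferInstance, (oneQF (-c)).prod Q, ?_, ?_,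
      (QIsom.refl _).witt⟩
    · apply h.aniso_of_not_mem hQ
      rwa [neg_neg]
    · rw [if_neg hc, Module.finrank_prod, Module.finrank_self]; push_cast; ring

lemma ClData.formula (h : ClData K cl) (h2 : (2 : K) ≠ 0) (hl : ∀ g, cl (lift g) = g) (a : ℕ) :
    ∀ (M : Type) [AddCommGroup M] [Module K M] [FiniteDimensional K M] (Q : QuadraticForm K M),
      Q.Anisotropic → (a + 1) % 2 = Module.finrank K M % 2 →
      8 * cnt lift (a + 1) Q = 4 ^ (a + 1) + (2 - (Module.finrank K M : ℤ)) * 2 ^ (a + 2) := by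
  induction a with
  | zero =>
    intro M _ _ _ Q hQ hpar
    have hcard := h.rep_card h2 _ M Q hQ rfl
    have hle : (repSet cl Q).card ≤ 4 := (Finset.card_le_univ _).trans (by decide)
    have key : ∀ g, cnt lift 0 ((oneQF (-(lift g))).prod Q) =
        if g ∈ repSet cl Q then (if Module.finrank K M = 1 then 1 else 0) else 0 := by
      intro g
      obtain ⟨M', _, _, _, Q', hQ', hd, hw⟩ := h.child h2 hQ (lift g)
      rw [hl] at hd
      rw [cnt_congr hw, cnt_zero hQ']
      split_ifs at hd ⊢ <;> first | rfl | omega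
    rw [cnt_succ h2, Finset.sum_congr rfl fun g _ => key g, ← Finset.sum_filter]
    simp only [Finset.filter_mem_eq_inter, Finset.univ_inter, Finset.sum_const, hcard]
    have : Module.finrank K M = 1 ∨ Module.finrank K M = 3 := by omega
    rcases this with h1 | h1 <;> simp [h1]
  | succ a ih =>
    intro M _ _ _ Q hQ hpar
    have hcard := h.rep_card h2 _ M Q hQ rfl
    have key : ∀ g, 8 * cnt lift (a + 1) ((oneQF (-(lift g))).prod Q) =
        4 ^ (a + 1) + (1 - (Module.finrank K M : ℤ)) * 2 ^ (a + 2) +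
          if g ∈ repSet cl Q then 2 * 2 ^ (a + 2) else 0 := by
      intro g
      obtain ⟨M', _, _, _, Q', hQ', hd, hw⟩ := h.child h2 hQ (lift g)
      rw [hl] at hd
      rw [cnt_congr hw, ih M' Q' hQ' (by split_ifs at hd <;> omega), hd]
      split_ifs <;> ring
    rw [cnt_succ h2, Finset.mul_sum, Finset.sum_congr rfl fun g _ => key g, Finset.sum_add_distrib,
      ← Finset.sum_filter]
    simp only [Finset.filter_mem_eq_inter, Finset.univ_inter, Finset.sum_const, hcard]
    have : (Finset.univ : Finset (ZMod 2 × ZMod 2)).card = 4 := by decide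
    rw [this]
    simp only [nsmul_eq_mul]
    push_cast
    ring

lemma ClData.quot_card (h : ClData K cl) (hl : ∀ g, cl (lift g) = g) (a : ℕ)
    (Q : QuadraticForm K M) :
    (Nat.card (Quot (fun
      (r r' : {r : Fin a → Kˣ // WittEquiv (diagQF r) Q}) =>
      ∀ i, ∃ u : Kˣ, r'.1 i = r.1 i * u ^ 2)) : ℤ) = cnt lift a Q := by
  classical
  have hlift : ∀ r : Fin a → Kˣ, QIsom (diagQF r) (diagQF (fun i => lift (cl (r i)))) :=
    fun r => diag_isom fun i => (h.eq_iff _ _).mp (hl _)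
  let T := {t : Fin a → ZMod 2 × ZMod 2 // WittEquiv (diagQF (fun i => lift (t i))) Q}
  have hT : (Nat.card T : ℤ) = cnt lift a Q := by
    rw [Nat.card_eq_fintype_card, Fintype.card_subtype, cnt, Finset.sum_boole]
  rw [← hT]
  congr 1
  refine Nat.card_congr (Equiv.ofBijective (Quot.lift (fun r =>
    (⟨fun i => cl (r.1 i), (hlift r.1).symm.witt.trans' r.2⟩ : T)) ?_) ⟨?_, ?_⟩)
  · intro r r' hr
    apply Subtype.ext
    funext i
    exact (h.eq_iff _ _).mpr (hr i)
  · rintro ⟨r⟩ ⟨r'⟩ hr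
    apply Quot.sound
    intro i
    exact (h.eq_iff _ _).mp (congrFun (congrArg Subtype.val hr) i)
  · rintro ⟨t, ht⟩
    refine ⟨Quot.mk _ ⟨fun i => lift (t i), ht⟩, ?_⟩
    apply Subtype.ext
    funext i
    exact hl _

end CountPart

lemma padic_cl (p : ℕ) [Fact p.Prime] (hp : p ≠ 2) (K : Type) [Field K]
    [Algebra ℚ_[p] K] [FiniteDimensional ℚ_[p] K] :
    ∃ cl : Kˣ → ZMod 2 × ZMod 2, ClData K cl := by
  let i1 : NontriviallyNormedField K := spectralNorm.nontriviallyNormedField ℚ_[p] K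
  have hnorm : ∀ x : K, ‖x‖ = spectralNorm ℚ_[p] K x := fun x => rfl
  let i2 : NormedSpace ℚ_[p] K :=
    { norm_smul_le := fun a x => by
        rw [Algebra.smul_def, norm_mul, hnorm, spectralNorm_extends] }
  have i3 : IsUltrametricDist K :=
    IsUltrametricDist.isUltrametricDist_of_isNonarchimedean_norm
      (isNonarchimedean_spectralNorm (K := ℚ_[p]) (L := K))
  have i4 : ProperSpace K := FiniteDimensional.proper ℚ_[p] K
  apply lf_cl
  have : (2 : K) = algebraMap ℚ_[p] K 2 := (map_ofNat _ 2).symm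
  rw [this, hnorm, spectralNorm_extends]
  have := (Padic.norm_natCast_eq_one_iff (p := p) (n := 2)).mpr
    ((Nat.coprime_primes Fact.out Nat.prime_two).mpr hp)
  exact_mod_cast this

/-- Lemma (count of diagonal `a`-tuples representing an anisotropic class). -/
theorem statement_7 (p : ℕ) [Fact p.Prime] (hp : p ≠ 2) (K : Type) [Field K]
    [Algebra ℚ_[p] K] [FiniteDimensional ℚ_[p] K]
    (d : ℕ) (Q₀ : QF K d) (hQ₀ : QuadraticMap.Anisotropic Q₀)
    (a : ℕ) (ha : 1 ≤ a) (hpar : a % 2 = d % 2)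
    (N : ℕ)
    (hN : N = Nat.card (Quot (fun
      (r r' : {r : Fin a → Kˣ // WittEquiv (diagQF r) Q₀}) =>
      ∀ i, ∃ u : Kˣ, r'.1 i = r.1 i * u ^ 2))) :
    (8 : ℤ) * N = 4 ^ a + (2 - (d : ℤ)) * 2 ^ (a + 1) := by
  obtain ⟨cl, h⟩ := padic_cl p hp K
  have h2 : (2 : K) ≠ 0 := by
    have : CharZero K := charZero_of_injective_algebraMap (algebraMap ℚ_[p] K).injective
    exact two_ne_zero
  have hl := Function.surjInv_eq h.surj
  obtain ⟨b, rfl⟩ : ∃ b, a = b + 1 := ⟨a - 1, by omega⟩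
  have h1 := h.formula h2 hl b (Fin d → K) Q₀ hQ₀ (by simpa using hpar)
  rw [hN, h.quot_card hl, h1]
  simp
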